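/- arXiv:math/0512186 — 8 statements merged into one kernel-verified Lean document; each statement's English description precedes it below -/
import Mathlib

section
/- Let n ≥ 2 and let A, B be n×n integer matrices. Then the pair (A,B) generates M_n(ℤ) (i.e., the non-unital subring of M_n(ℤ) generated by A and B is all of M_n(ℤ)) if and only if for every prime p, the pair of mod-p reductions of A and B generates M_n(ℤ/pℤ) (i.e., the non-unital subring of M_n(ℤ/pℤ) generated by the reductions is all of M_n(ℤ/pℤ)). -/
/-- A pair `(A, B)` of `n × n` matrices over a commutative ring `R` generates `M_n(R)`
if the non-unital `R`-subalgebra of `M_n(R)` generated by `A` and `B`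
(the smallest subset containing `A` and `B` closed under addition, negation,
multiplication, and scalar multiplication by `R`) is all of `M_n(R)`. -/
def Generates {n : ℕ} (R : Type*) [CommRing R] (A B : Matrix (Fin n) (Fin n) R) : Prop :=
  NonUnitalAlgebra.adjoin R ({A, B} : Set (Matrix (Fin n) (Fin n) R)) = ⊤

/-- Along a surjective ring homomorphism, adjoining commutes with entrywise matrix maps. -/
theorem mem_adjoin_image_mapMatrix_iff {m R S : Type*} [Fintype m] [DecidableEq m]
    [CommRing R] [CommRing S] {f : R →+* S} (hf : Function.Surjective f)
    (s : Set (Matrix m m R)) (y : Matrix m m S) :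
    y ∈ NonUnitalAlgebra.adjoin S (f.mapMatrix '' s) ↔
      ∃ x ∈ NonUnitalAlgebra.adjoin R s, f.mapMatrix x = y := by
  constructor
  · intro hy
    induction hy using NonUnitalAlgebra.adjoin_induction with
    | mem y hy =>
      obtain ⟨x, hx, rfl⟩ := hy
      exact ⟨x, NonUnitalAlgebra.subset_adjoin R hx, rfl⟩
    | add _ _ _ _ ihx ihy =>
      obtain ⟨⟨x, hx, rfl⟩, y, hy, rfl⟩ := ihx, ihy
      exact ⟨x + y, add_mem hx hy, map_add _ _ _⟩
    | zero => exact ⟨0, zero_mem _, map_zero _⟩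
    | mul _ _ _ _ ihx ihy =>
      obtain ⟨⟨x, hx, rfl⟩, y, hy, rfl⟩ := ihx, ihy
      exact ⟨x * y, mul_mem hx hy, map_mul _ _ _⟩
    | smul c _ _ ih =>
      obtain ⟨x, hx, rfl⟩ := ih
      obtain ⟨r, rfl⟩ := hf c
      exact ⟨r • x, SMulMemClass.smul_mem r hx, by ext i j; simp⟩
  · rintro ⟨x, hx, rfl⟩
    induction hx using NonUnitalAlgebra.adjoin_induction with
    | mem x hx => exact NonUnitalAlgebra.subset_adjoin S ⟨x, hx, rfl⟩
    | add x y _ _ ihx ihy => simpa only [map_add] using add_mem ihx ihy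
    | zero => simp only [map_zero, zero_mem]
    | mul x y _ _ ihx ihy => simpa only [map_mul] using mul_mem ihx ihy
    | smul r x _ ih =>
      have h : f.mapMatrix (r • x) = f r • f.mapMatrix x := by ext i j; simp
      exact h ▸ SMulMemClass.smul_mem (f r) ih

/-- A subgroup of a finitely generated abelian group which surjects onto every quotient `M / pM`,
`p` prime, is everything. -/
theorem Submodule.eq_top_of_forall_prime_exists_add_smul {M : Type*} [AddCommGroup M]
    [Module.Finite ℤ M] (N : Submodule ℤ M)
    (h : ∀ p : ℕ, p.Prime → ∀ x : M, ∃ y ∈ N, ∃ z : M, x = y + (p : ℤ) • z) : N = ⊤ := by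
  by_contra hN
  have hann : Module.annihilator ℤ (M ⧸ N) ≠ ⊤ := by
    rwa [Ne, Module.annihilator_eq_top_iff, Submodule.Quotient.subsingleton_iff]
  obtain ⟨P, hP, hle⟩ := Ideal.exists_le_maximal _ hann
  obtain ⟨p, hp, hpP⟩ : ∃ p : ℕ, p.Prime ∧ (p : ℤ) ∈ P := by
    have hne : P ≠ ⊥ := Ring.ne_bot_of_isMaximal_of_not_isField hP Int.not_isField
    obtain ⟨g, rfl⟩ := (inferInstance : P.IsPrincipal).principal
    have hg : Prime g :=
      (Ideal.span_singleton_prime fun h0 => hne (by simp [h0])).mp hP.isPrime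
    exact ⟨g.natAbs, Int.prime_iff_natAbs_prime.mp hg,
      Ideal.mem_span_singleton.mpr (Int.dvd_natAbs.mpr dvd_rfl)⟩
  obtain ⟨r, hr, hr0⟩ := Submodule.exists_sub_one_mem_and_smul_eq_zero_of_fg_of_le_smul P
    (⊤ : Submodule ℤ (M ⧸ N)) Module.Finite.fg_top (by
      intro q _
      obtain ⟨x, rfl⟩ := N.mkQ_surjective q
      obtain ⟨y, hy, z, rfl⟩ := h p hp x
      rw [map_add, map_smul, N.mkQ_apply y, (Submodule.Quotient.mk_eq_zero N).mpr hy, zero_add]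
      exact Submodule.smul_mem_smul hpP trivial)
  have hrP : r ∈ P := hle (Module.mem_annihilator.mpr fun q => hr0 q trivial)
  exact hP.ne_top ((Ideal.eq_top_iff_one P).mpr (by simpa using sub_mem hrP hr))

theorem Matrix.exists_eq_smul_of_map_intCast_eq_zero {m k : Type*} {p : ℕ} {X : Matrix m k ℤ}
    (h : ∀ i j, (X i j : ZMod p) = 0) : ∃ Z : Matrix m k ℤ, X = (p : ℤ) • Z := by
  choose Z hZ using fun i j => (ZMod.intCast_zmod_eq_zero_iff_dvd (X i j) p).mp (h i j)
  exact ⟨Matrix.of Z, by ext i j; simpa using hZ i j⟩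

theorem stmt_0 (n : ℕ) (hn : 2 ≤ n) (A B : Matrix (Fin n) (Fin n) ℤ) :
    Generates ℤ A B ↔
      ∀ p : ℕ, p.Prime →
        Generates (ZMod p) (A.map (Int.cast : ℤ → ZMod p))
          (B.map (Int.cast : ℤ → ZMod p)) := by
  have key (p : ℕ) (Y : Matrix (Fin n) (Fin n) (ZMod p)) :
      Y ∈ NonUnitalAlgebra.adjoin (ZMod p) {A.map (Int.cast : ℤ → ZMod p),
        B.map (Int.cast : ℤ → ZMod p)} ↔
      ∃ X ∈ NonUnitalAlgebra.adjoin ℤ {A, B}, (Int.castRingHom (ZMod p)).mapMatrix X = Y := by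
    rw [← mem_adjoin_image_mapMatrix_iff (ZMod.ringHom_surjective _), Set.image_pair]
    rfl
  unfold Generates
  constructor
  · intro h p _
    refine NonUnitalAlgebra.eq_top_iff.mpr fun Y => (key p Y).mpr ?_
    choose X hX using fun i j => ZMod.intCast_surjective (Y i j)
    exact ⟨Matrix.of X, h ▸ NonUnitalAlgebra.mem_top, by ext i j; simpa using hX i j⟩
  · intro h
    rw [← NonUnitalAlgebra.toSubmodule_eq_top]
    refine Submodule.eq_top_of_forall_prime_exists_add_smul _ fun p hp X => ?_
    obtain ⟨Y, hY, hYX⟩ := (key p ((Int.castRingHom (ZMod p)).mapMatrix X)).mp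
      (h p hp ▸ NonUnitalAlgebra.mem_top)
    obtain ⟨Z, hZ⟩ := Matrix.exists_eq_smul_of_map_intCast_eq_zero (p := p) (X := X - Y)
      fun i j => by
        have := congrFun (congrFun hYX i) j
        simp only [RingHom.mapMatrix_apply, Matrix.map_apply, eq_intCast] at this
        simp [this]
    exact ⟨Y, hY, Z, by rw [← hZ, add_sub_cancel]⟩
end

section
/- Let F be a field, n ≥ 2, and let A, B be n×n matrices over F such that the pair (A,B) generates M_n(F). Then the F-linear span of the set of all matrices w(A,B), where w ranges over the nonempty words of length at most n²−1 in two letters, is all of M_n(F). -/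
/-- The set of all matrices `w(A,B)` for nonempty words `w` of length at most `m`
in the two letters `A`, `B`: a word is a nonempty list over `Fin 2`, evaluated by
substituting `A` for `0` and `B` for `1` and taking the product. -/
def wordValues {n : ℕ} {R : Type*} [CommRing R] (A B : Matrix (Fin n) (Fin n) R) (m : ℕ) :
    Set (Matrix (Fin n) (Fin n) R) :=
  { M | ∃ w : List (Fin 2), w ≠ [] ∧ w.length ≤ m ∧
      (w.map fun i => if i = 0 then A else B).prod = M }

section Words

variable {F : Type*} [Field F] {n : ℕ} {A B : Matrix (Fin n) (Fin n) F}

theorem left_mem_span_wordValues {m : ℕ} (hm : 1 ≤ m) :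
    A ∈ Submodule.span F (wordValues A B m) :=
  Submodule.subset_span ⟨[0], by simp, by simpa using hm, by simp⟩

theorem right_mem_span_wordValues {m : ℕ} (hm : 1 ≤ m) :
    B ∈ Submodule.span F (wordValues A B m) :=
  Submodule.subset_span ⟨[1], by simp, by simpa using hm, by simp⟩

theorem span_wordValues_mono {m k : ℕ} (hmk : m ≤ k) :
    Submodule.span F (wordValues A B m) ≤ Submodule.span F (wordValues A B k) :=
  Submodule.span_mono fun _ ⟨w, hw, hl, hM⟩ => ⟨w, hw, hl.trans hmk, hM⟩

theorem letter_mul_mem_span_wordValues {m : ℕ} (i : Fin 2) {X : Matrix (Fin n) (Fin n) F}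
    (hX : X ∈ Submodule.span F (wordValues A B m)) :
    (if i = 0 then A else B) * X ∈ Submodule.span F (wordValues A B (m + 1)) := by
  induction hX using Submodule.span_induction with
  | mem x hx =>
    obtain ⟨w, -, hl, rfl⟩ := hx
    exact Submodule.subset_span ⟨i :: w, by simp, by simpa using hl, by simp⟩
  | zero => simp
  | add x y _ _ hx hy => rw [mul_add]; exact add_mem hx hy
  | smul c x _ hx => rw [mul_smul_comm]; exact Submodule.smul_mem _ c hx

theorem Generates.span_wordValues_eq_top_of_le (h : Generates F A B) {m : ℕ} (hm : 1 ≤ m)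
    (hle : Submodule.span F (wordValues A B (m + 1)) ≤ Submodule.span F (wordValues A B m)) :
    Submodule.span F (wordValues A B m) = ⊤ := by
  refine eq_top_iff.2 fun X _ => ?_
  have hX : X ∈ NonUnitalAlgebra.adjoin F ({A, B} : Set (Matrix (Fin n) (Fin n) F)) := by
    rw [show NonUnitalAlgebra.adjoin F _ = ⊤ from h]; trivial
  suffices X ∈ Submodule.span F (wordValues A B m) ∧
      ∀ Y ∈ Submodule.span F (wordValues A B m), X * Y ∈ Submodule.span F (wordValues A B m) from
    this.1
  induction hX using NonUnitalAlgebra.adjoin_induction with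
  | mem x hx =>
    rcases hx with rfl | rfl
    · exact ⟨left_mem_span_wordValues hm, fun Y hY =>
        hle (by simpa using letter_mul_mem_span_wordValues 0 hY)⟩
    · exact ⟨right_mem_span_wordValues hm, fun Y hY =>
        hle (by simpa using letter_mul_mem_span_wordValues 1 hY)⟩
  | zero => simp
  | add x y _ _ hx hy =>
    refine ⟨add_mem (hx trivial).1 (hy trivial).1, fun Y hY => ?_⟩
    rw [add_mul]
    exact add_mem ((hx trivial).2 Y hY) ((hy trivial).2 Y hY)
  | mul x y _ _ hx hy =>
    refine ⟨(hx trivial).2 y (hy trivial).1, fun Y hY => ?_⟩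
    rw [mul_assoc]
    exact (hx trivial).2 _ ((hy trivial).2 Y hY)
  | smul c x _ hx =>
    refine ⟨Submodule.smul_mem _ c (hx trivial).1, fun Y hY => ?_⟩
    rw [smul_mul_assoc]
    exact Submodule.smul_mem _ c ((hx trivial).2 Y hY)

theorem Generates.commute_of_commute (h : Generates F A B) (hAB : Commute A B)
    (X Y : Matrix (Fin n) (Fin n) F) : Commute X Y := by
  have key : ∀ Z, Commute A Z → Commute B Z → ∀ X, Commute X Z := by
    intro Z hA hB X
    have hX : X ∈ NonUnitalAlgebra.adjoin F ({A, B} : Set (Matrix (Fin n) (Fin n) F)) := by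
      rw [show NonUnitalAlgebra.adjoin F _ = ⊤ from h]; trivial
    induction hX using NonUnitalAlgebra.adjoin_induction with
    | mem x hx => rcases hx with rfl | rfl <;> assumption
    | zero => exact Commute.zero_left Z
    | add x y _ _ hx hy => exact hx.add_left hy
    | mul x y _ _ hx hy => exact hx.mul_left hy
    | smul c x _ hx => exact hx.smul_left c
  exact key Y (key A (Commute.refl A) hAB.symm Y).symm (key B hAB (Commute.refl B) Y).symm X

theorem Generates.not_commute (h : Generates F A B) (hn : 2 ≤ n) : ¬ Commute A B := by
  intro hAB
  let i : Fin n := ⟨0, by lia⟩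
  let j : Fin n := ⟨1, by lia⟩
  have hij : j ≠ i := by simp [i, j]
  have hc := (h.commute_of_commute hAB (Matrix.single i i 1) (Matrix.single i j 1)).eq
  rw [Matrix.single_mul_single_same, Matrix.single_mul_single_of_ne (h := hij)] at hc
  simpa using congrFun (congrFun hc i) j

theorem Generates.two_le_finrank_span_wordValues (h : Generates F A B) (hn : 2 ≤ n) :
    2 ≤ Module.finrank F (Submodule.span F (wordValues A B 1)) := by
  by_contra! hlt
  obtain ⟨v, hv⟩ := finrank_le_one_iff.1 (Nat.le_of_lt_succ hlt)
  obtain ⟨a, ha⟩ := hv ⟨A, left_mem_span_wordValues le_rfl⟩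
  obtain ⟨b, hb⟩ := hv ⟨B, right_mem_span_wordValues le_rfl⟩
  have hva : a • (v : Matrix (Fin n) (Fin n) F) = A := congrArg Subtype.val ha
  have hvb : b • (v : Matrix (Fin n) (Fin n) F) = B := congrArg Subtype.val hb
  have hcomm := ((Commute.refl (v : Matrix (Fin n) (Fin n) F)).smul_left a).smul_right b
  rw [hva, hvb] at hcomm
  exact h.not_commute hn hcomm

theorem Generates.span_wordValues_eq_top_or_lt_finrank (h : Generates F A B) (hn : 2 ≤ n)
    {m : ℕ} (hm : 1 ≤ m) :
    Submodule.span F (wordValues A B m) = ⊤ ∨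
      m < Module.finrank F (Submodule.span F (wordValues A B m)) := by
  induction m, hm using Nat.le_induction with
  | base => exact .inr (h.two_le_finrank_span_wordValues hn)
  | succ m hm ih =>
    have hmono := span_wordValues_mono (F := F) (A := A) (B := B) m.le_succ
    rcases ih with htop | hlt
    · exact .inl (top_le_iff.1 (htop ▸ hmono))
    · by_cases hle : Submodule.span F (wordValues A B (m + 1)) ≤
          Submodule.span F (wordValues A B m)
      · exact .inl (top_le_iff.1 (h.span_wordValues_eq_top_of_le hm hle ▸ hmono))
      · have := Submodule.finrank_lt_finrank_of_lt (lt_of_le_not_ge hmono hle)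
        exact .inr (by lia)

end Words

theorem stmt_1 (F : Type*) [Field F] (n : ℕ) (hn : 2 ≤ n)
    (A B : Matrix (Fin n) (Fin n) F) (h : Generates F A B) :
    Submodule.span F (wordValues A B (n ^ 2 - 1)) = ⊤ := by
  have hsq : 2 ^ 2 ≤ n ^ 2 := Nat.pow_le_pow_left hn 2
  rcases h.span_wordValues_eq_top_or_lt_finrank hn (m := n ^ 2 - 1) (by lia) with htop | hlt
  · exact htop
  · refine Submodule.eq_top_of_finrank_eq (le_antisymm (Submodule.finrank_le _) ?_)
    rw [Module.finrank_matrix, Module.finrank_self, Fintype.card_fin, mul_one, ← sq]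
    lia
end

section
/- Let A, B be 2×2 integer matrices. Then the pair (A,B) generates M_2(ℤ) if and only if both of the following hold: (1) gcd(det A, det B, det(A+B)) = 1, and (2) the subring of M_2(ℤ) generated by the four matrices I₂, A, B, AB is all of M_2(ℤ). -/
namespace Matrix

section CommRing

variable {R : Type*} [CommRing R]

/-- The Cayley–Hamilton theorem for `2 × 2` matrices. -/
theorem mul_self_fin_two (A : Matrix (Fin 2) (Fin 2) R) :
    A * A = A.trace • A - A.det • 1 := by
  ext i j
  fin_cases i <;> fin_cases j <;>
    simp [Matrix.mul_apply, Fin.sum_univ_two, Matrix.trace_fin_two, Matrix.det_fin_two] <;> ring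

/-- The polarized Cayley–Hamilton theorem for `2 × 2` matrices. -/
theorem mul_add_mul_swap_fin_two (A B : Matrix (Fin 2) (Fin 2) R) :
    A * B + B * A =
      B.trace • A + A.trace • B - ((A + B).det - A.det - B.det) • 1 := by
  ext i j
  fin_cases i <;> fin_cases j <;>
    simp [Matrix.mul_apply, Fin.sum_univ_two, Matrix.trace_fin_two, Matrix.det_fin_two] <;> ring

theorem det_smul_one_mem_of_mem_fin_two {S : NonUnitalSubalgebra R (Matrix (Fin 2) (Fin 2) R)}
    {A : Matrix (Fin 2) (Fin 2) R} (hA : A ∈ S) : A.det • (1 : Matrix (Fin 2) (Fin 2) R) ∈ S := by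
  have h : A.det • (1 : Matrix (Fin 2) (Fin 2) R) = A.trace • A - A * A := by
    rw [mul_self_fin_two]; abel
  rw [h]
  exact sub_mem (SMulMemClass.smul_mem _ hA) (mul_mem hA hA)

open scoped Pointwise in
theorem adjoin_pair_le_span_of_det_eq_zero {A B : Matrix (Fin 2) (Fin 2) R}
    (hA : A.det = 0) (hB : B.det = 0) (hAB : (A + B).det = 0) :
    (NonUnitalAlgebra.adjoin R {A, B}).toSubmodule ≤ Submodule.span R {A, B, A * B} := by
  set M := Submodule.span R {A, B, A * B} with hM
  have mA : A ∈ M := Submodule.subset_span (by simp)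
  have mB : B ∈ M := Submodule.subset_span (by simp)
  have mAB : A * B ∈ M := Submodule.subset_span (by simp)
  have hAA : A * A = A.trace • A := by simpa [hA] using mul_self_fin_two A
  have hBB : B * B = B.trace • B := by simpa [hB] using mul_self_fin_two B
  have hBA : B * A = B.trace • A + A.trace • B - A * B := by
    have := mul_add_mul_swap_fin_two A B
    simp only [hA, hB, hAB, sub_zero, zero_smul] at this
    rw [← this]; abel
  have hABA : A * (B * A) = (B.trace * A.trace) • A := by
    rw [hBA, mul_sub, mul_add, ← mul_assoc, hAA]
    simp [hAA, smul_smul]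
  have hBAB : B * (A * B) = (A.trace * B.trace) • B := by
    rw [← mul_assoc, hBA, sub_mul, add_mul, mul_assoc, hBB]
    simp [hBB, smul_smul]
  have hMM : M * M ≤ M := by
    rw [hM, Submodule.span_mul_span, Submodule.span_le, ← hM, Set.mul_subset_iff]
    have hAAB : A * (A * B) ∈ M := by
      rw [← mul_assoc, hAA, smul_mul_assoc]; exact M.smul_mem _ mAB
    have hABB : A * B * B ∈ M := by
      rw [mul_assoc, hBB, mul_smul_comm]; exact M.smul_mem _ mAB
    have hABAB : A * B * (A * B) ∈ M := by
      rw [mul_assoc, hBAB, mul_smul_comm]; exact M.smul_mem _ mAB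
    have hBA' : B * A ∈ M := by
      rw [hBA]; exact sub_mem (add_mem (M.smul_mem _ mA) (M.smul_mem _ mB)) mAB
    have hABA' : A * B * A ∈ M := by rw [mul_assoc, hABA]; exact M.smul_mem _ mA
    have hBAB' : B * (A * B) ∈ M := by rw [hBAB]; exact M.smul_mem _ mB
    have hAA' : A * A ∈ M := by rw [hAA]; exact M.smul_mem _ mA
    have hBB' : B * B ∈ M := by rw [hBB]; exact M.smul_mem _ mB
    rintro x (rfl | rfl | rfl) y (rfl | rfl | rfl) <;> assumption
  intro X hX
  induction hX using NonUnitalAlgebra.adjoin_induction with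
  | mem x hx => rcases hx with rfl | rfl <;> assumption
  | add x y _ _ hx hy => exact add_mem hx hy
  | zero => exact zero_mem _
  | mul x y _ _ hx hy => exact hMM (Submodule.mul_mem_mul hx hy)
  | smul r x _ hx => exact M.smul_mem r hx

end CommRing

end Matrix

theorem Generates.map {n : ℕ} {R S : Type*} [CommRing R] [CommRing S] {f : R →+* S}
    (hf : Function.Surjective f) {A B : Matrix (Fin n) (Fin n) R} (h : Generates R A B) :
    Generates S (f.mapMatrix A) (f.mapMatrix B) := by
  refine eq_top_iff.2 fun Y _ => ?_
  obtain ⟨X, rfl⟩ : ∃ X, f.mapMatrix X = Y := by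
    choose g hg using hf
    exact ⟨Y.map g, by ext; simp [hg]⟩
  have hX : X ∈ NonUnitalAlgebra.adjoin R {A, B} := by rw [h]; trivial
  induction hX using NonUnitalAlgebra.adjoin_induction with
  | mem x hx =>
    refine NonUnitalAlgebra.subset_adjoin S ?_
    rcases hx with rfl | rfl <;> simp
  | add x y _ _ hx hy => rw [map_add]; exact add_mem (hx trivial) (hy trivial)
  | zero => rw [map_zero]; exact zero_mem _
  | mul x y _ _ hx hy => rw [map_mul]; exact mul_mem (hx trivial) (hy trivial)
  | smul r x _ hx =>
    have : f.mapMatrix (r • x) = f r • f.mapMatrix x := by ext; simp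
    rw [this]
    exact SMulMemClass.smul_mem _ (hx trivial)

theorem Generates.not_det_eq_zero {K : Type*} [Field K] {A B : Matrix (Fin 2) (Fin 2) K}
    (h : Generates K A B) : ¬ (A.det = 0 ∧ B.det = 0 ∧ (A + B).det = 0) := by
  rintro ⟨hA, hB, hAB⟩
  classical
  have hle := Matrix.adjoin_pair_le_span_of_det_eq_zero hA hB hAB
  have htop : Submodule.span K (({A, B, A * B} : Finset (Matrix (Fin 2) (Fin 2) K)) :
      Set (Matrix (Fin 2) (Fin 2) K)) = ⊤ := by
    refine eq_top_iff.2 fun X _ => ?_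
    have hX : X ∈ NonUnitalAlgebra.adjoin K {A, B} := by rw [h]; trivial
    simpa using hle hX
  have h4 : Module.finrank K (Matrix (Fin 2) (Fin 2) K) = 4 := by
    simp [Module.finrank_matrix]
  have h3 := finrank_span_finset_le_card (R := K)
    ({A, B, A * B} : Finset (Matrix (Fin 2) (Fin 2) K))
  rw [Set.finrank, htop, finrank_top, h4] at h3
  exact absurd (h3.trans Finset.card_le_three) (by norm_num)

theorem stmt_3 (A B : Matrix (Fin 2) (Fin 2) ℤ) :
    Generates ℤ A B ↔
      (Int.gcd (Int.gcd A.det B.det) (A + B).det = 1 ∧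
        Subring.closure ({1, A, B, A * B} : Set (Matrix (Fin 2) (Fin 2) ℤ)) = ⊤) := by
  constructor
  · intro h
    constructor
    · by_contra hne
      obtain ⟨p, hp, hdvd⟩ := Nat.exists_prime_and_dvd hne
      have : Fact p.Prime := ⟨hp⟩
      have hdvd' : (p : ℤ) ∣ (Int.gcd A.det B.det : ℤ) :=
        (Int.natCast_dvd_natCast.2 hdvd).trans (Int.gcd_dvd_left ..)
      refine (h.map (f := Int.castRingHom (ZMod p)) (ZMod.ringHom_surjective _)).not_det_eq_zero ?_
      simp only [← map_add, ← RingHom.map_det, eq_intCast, ZMod.intCast_zmod_eq_zero_iff_dvd]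
      exact ⟨hdvd'.trans (Int.gcd_dvd_left ..), hdvd'.trans (Int.gcd_dvd_right ..),
        (Int.natCast_dvd_natCast.2 hdvd).trans (Int.gcd_dvd_right ..)⟩
    · refine eq_top_iff.2 fun X _ => ?_
      have hX : X ∈ NonUnitalAlgebra.adjoin ℤ {A, B} := by rw [h]; trivial
      induction hX using NonUnitalAlgebra.adjoin_induction with
      | mem x hx =>
        refine Subring.subset_closure ?_
        rcases hx with rfl | rfl <;> simp
      | add x y _ _ hx hy => exact add_mem (hx trivial) (hy trivial)
      | zero => exact zero_mem _
      | mul x y _ _ hx hy => exact mul_mem (hx trivial) (hy trivial)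
      | smul r x _ hx => exact zsmul_mem (hx trivial) r
  · rintro ⟨hgcd, hcl⟩
    set S := NonUnitalAlgebra.adjoin ℤ {A, B} with hS
    have mA : A ∈ S := NonUnitalAlgebra.subset_adjoin ℤ (by simp)
    have mB : B ∈ S := NonUnitalAlgebra.subset_adjoin ℤ (by simp)
    have one_mem : (1 : Matrix (Fin 2) (Fin 2) ℤ) ∈ S := by
      have gcd_mem {a b : ℤ} (ha : a • (1 : Matrix (Fin 2) (Fin 2) ℤ) ∈ S)
          (hb : b • (1 : Matrix (Fin 2) (Fin 2) ℤ) ∈ S) :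
          (Int.gcd a b : ℤ) • (1 : Matrix (Fin 2) (Fin 2) ℤ) ∈ S := by
        rw [Int.gcd_eq_gcd_ab, add_smul, mul_comm a, mul_comm b, mul_smul, mul_smul]
        exact add_mem (zsmul_mem ha _) (zsmul_mem hb _)
      have := gcd_mem (gcd_mem (Matrix.det_smul_one_mem_of_mem_fin_two mA)
        (Matrix.det_smul_one_mem_of_mem_fin_two mB))
        (Matrix.det_smul_one_mem_of_mem_fin_two (add_mem mA mB))
      simpa [hgcd] using this
    refine eq_top_iff.2 fun X _ => ?_
    have hX : X ∈ Subring.closure ({1, A, B, A * B} : Set (Matrix (Fin 2) (Fin 2) ℤ)) := by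
      rw [hcl]; trivial
    rw [← hS]
    induction hX using Subring.closure_induction with
    | mem x hx =>
      rcases hx with rfl | rfl | rfl | rfl
      exacts [one_mem, mA, mB, mul_mem mA mB]
    | zero => exact zero_mem _
    | one => exact one_mem
    | add x y _ _ hx hy => exact add_mem (hx trivial) (hy trivial)
    | neg x _ hx => exact neg_mem (hx trivial)
    | mul x y _ _ hx hy => exact mul_mem (hx trivial) (hy trivial)
end

section
/- Let a, b, c be integers with gcd(a,b) = 1, and let A₁ = [[c,1],[1,0]] and B₁ = [[a,0],[b,0]] be 2×2 integer matrices. Then the subring of M_2(ℤ) generated by I₂, A₁, B₁ is all of M_2(ℤ) if and only if a² − abc − b² = 1 or a² − abc − b² = −1. -/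
/-- The additive span of `1`, `A = !![c, 1; 1, 0]`, `B = !![a, 0; b, 0]` and `A * B`, described by
its entries; it is closed under multiplication. -/
def spanSubring (a b c : ℤ) : Subring (Matrix (Fin 2) (Fin 2) ℤ) where
  carrier := {M | ∃ z w : ℤ, M 0 0 = M 1 1 + c * M 0 1 + z * a + w * (c * a + b) ∧
    M 1 0 = M 0 1 + z * b + w * a}
  zero_mem' := ⟨0, 0, by simp, by simp⟩
  one_mem' := ⟨0, 0, by simp, by simp⟩
  add_mem' := by
    rintro M N ⟨z, w, h₁, h₂⟩ ⟨z', w', h₃, h₄⟩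
    refine ⟨z + z', w + w', ?_, ?_⟩ <;> simp only [Matrix.add_apply, h₁, h₂, h₃, h₄] <;> ring
  neg_mem' := by
    rintro M ⟨z, w, h₁, h₂⟩
    refine ⟨-z, -w, ?_, ?_⟩ <;> simp only [Matrix.neg_apply, h₁, h₂] <;> ring
  mul_mem' := by
    rintro M N ⟨z, w, h₁, h₂⟩ ⟨z', w', h₃, h₄⟩
    refine ⟨M 1 1 * z' + z * N 1 1 + M 0 1 * w' + c * z * N 0 1 + a * z * z'
        + (c * a + b) * z * w' - w * N 0 1,
      M 1 1 * w' + w * N 1 1 + M 0 1 * z' + c * M 0 1 * w' - z * N 0 1 + a * w * z'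
        + (c * a + b) * w * w', ?_, ?_⟩ <;>
    simp only [Matrix.mul_apply, Fin.sum_univ_two, h₁, h₂, h₃, h₄] <;> ring

theorem closure_le_spanSubring (a b c : ℤ) :
    Subring.closure
        ({1, !![c, 1; 1, 0], !![a, 0; b, 0]} : Set (Matrix (Fin 2) (Fin 2) ℤ)) ≤
      spanSubring a b c := by
  rw [Subring.closure_le]
  rintro M (rfl | rfl | rfl)
  · exact one_mem _
  · exact ⟨0, 0, by simp, by simp⟩
  · exact ⟨1, 0, by simp, by simp⟩

theorem isUnit_of_spanSubring_eq_top {a b c : ℤ} (h : spanSubring a b c = ⊤) :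
    IsUnit (a ^ 2 - a * b * c - b ^ 2) := by
  have mem (M : Matrix (Fin 2) (Fin 2) ℤ) : M ∈ spanSubring a b c := h ▸ Subring.mem_top M
  obtain ⟨z, w, h₁, h₂⟩ := mem !![1, 0; 0, 0]
  obtain ⟨z', w', h₃, h₄⟩ := mem !![0, 0; 1, 0]
  simp at h₁ h₂ h₃ h₄
  refine .of_mul_eq_one (z * w' - w * z') ?_
  linear_combination (-z' * b - w' * a) * h₁ + (z' * a + w' * (c * a + b)) * h₂ - h₄

/-- A subring containing `A` and `B` is everything if `a ^ 2 - a * b * c - b ^ 2` is a unit: it then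
contains the matrix units of the first column. -/
theorem eq_top_of_isUnit {a b c : ℤ} {S : Subring (Matrix (Fin 2) (Fin 2) ℤ)}
    (hA : !![c, 1; 1, 0] ∈ S) (hB : !![a, 0; b, 0] ∈ S)
    (hd : IsUnit (a ^ 2 - a * b * c - b ^ 2)) : S = ⊤ := by
  obtain ⟨e, he⟩ := hd.exists_right_inv
  have hAB := mul_mem hA hB
  have h₁ : !![1, 0; 0, 0] ∈ S := by
    convert sub_mem (zsmul_mem hB (e * a)) (zsmul_mem hAB (e * b)) using 1
    ext i j
    fin_cases i <;> fin_cases j <;> simp <;> grind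
  have h₂ : !![0, 0; 1, 0] ∈ S := by
    convert sub_mem (zsmul_mem hAB (e * a)) (zsmul_mem hB (e * (c * a + b))) using 1
    ext i j
    fin_cases i <;> fin_cases j <;> simp <;> grind
  rw [eq_top_iff]
  intro M _
  convert add_mem (add_mem (zsmul_mem (one_mem S) (M 1 1)) (zsmul_mem hA (M 0 1)))
    (add_mem (zsmul_mem h₁ (M 0 0 - M 1 1 - c * M 0 1)) (zsmul_mem h₂ (M 1 0 - M 0 1))) using 1
  ext i j
  fin_cases i <;> fin_cases j <;> simp [Matrix.intCast_apply, mul_comm c]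

theorem stmt_4 (a b c : ℤ) (h : Int.gcd a b = 1) :
    Subring.closure
        ({1, !![c, 1; 1, 0], !![a, 0; b, 0]} : Set (Matrix (Fin 2) (Fin 2) ℤ)) = ⊤ ↔
      (a ^ 2 - a * b * c - b ^ 2 = 1 ∨ a ^ 2 - a * b * c - b ^ 2 = -1) := by
  rw [← Int.isUnit_iff]
  refine ⟨fun htop ↦ isUnit_of_spanSubring_eq_top ?_, fun hd ↦ eq_top_of_isUnit
    (Subring.subset_closure (by simp)) (Subring.subset_closure (by simp)) hd⟩
  exact top_le_iff.mp (htop ▸ closure_le_spanSubring a b c)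
end

section
/- Let F be a normed field such that for every ε > 0 there exists a nonzero element a of F with ‖a‖ < ε, and let n ≥ 2. Then the set G_n(F) of pairs (A,B) of n×n matrices over F that generate M_n(F) is open and dense in M_n(F) × M_n(F) in the norm topology. -/
open Matrix Topology

/-- The value of a nonempty word in two letters at the pair `(A, B)`. -/
def wordEval {M : Type*} [Semigroup M] (A B : M) : FreeSemigroup Bool →ₙ* M :=
  FreeSemigroup.lift fun b => cond b A B

/-- The determinant of the coordinate matrix of a family of words evaluated at `(A, B)`. -/
def wordDet {ι R : Type*} [Fintype ι] [DecidableEq ι] [CommRing R]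
    (w : ι × ι → FreeSemigroup Bool) (A B : Matrix ι ι R) : R :=
  (Matrix.of fun k => (wordEval A B (w k)).vec).det

section wordEval

variable {M N : Type*} [Semigroup M] [Semigroup N]

theorem coe_closure_pair_eq_range_wordEval (A B : M) :
    (Subsemigroup.closure {A, B} : Set M) = Set.range (wordEval A B) := by
  rw [← MulHom.coe_srange, SetLike.coe_set_eq]
  apply le_antisymm
  · rw [Subsemigroup.closure_le, Set.insert_subset_iff, Set.singleton_subset_iff]
    exact ⟨⟨FreeSemigroup.of true, by simp [wordEval]⟩,
      ⟨FreeSemigroup.of false, by simp [wordEval]⟩⟩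
  · rintro _ ⟨w, rfl⟩
    induction w using FreeSemigroup.recOnMul with
    | ih1 b => cases b <;> exact Subsemigroup.subset_closure (by simp [wordEval])
    | ih2 b w hb hw => rw [map_mul]; exact mul_mem hb hw

theorem map_wordEval (f : M →ₙ* N) (A B : M) (w : FreeSemigroup Bool) :
    f (wordEval A B w) = wordEval (f A) (f B) w := by
  induction w using FreeSemigroup.recOnMul with
  | ih1 b => cases b <;> simp [wordEval]
  | ih2 b w hb hw => rw [map_mul, map_mul, map_mul, hb, hw]

theorem continuous_wordEval [TopologicalSpace M] [ContinuousMul M] (w : FreeSemigroup Bool) :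
    Continuous fun p : M × M => wordEval p.1 p.2 w := by
  induction w using FreeSemigroup.recOnMul with
  | ih1 b => cases b <;> simp only [wordEval, FreeSemigroup.lift_of, cond] <;> fun_prop
  | ih2 b w hb hw => simp only [map_mul]; exact hb.mul hw

end wordEval

section wordDet

variable {ι R S : Type*} [Fintype ι] [DecidableEq ι] [CommRing R] [CommRing S]

theorem map_wordDet (f : R →+* S) (w : ι × ι → FreeSemigroup Bool) (A B : Matrix ι ι R) :
    f (wordDet w A B) = wordDet w (A.map f) (B.map f) := by
  rw [wordDet, wordDet, RingHom.map_det]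
  congr 1
  ext k x
  have := map_wordEval
    ((f.mapMatrix : Matrix ι ι R →+* Matrix ι ι S) : Matrix ι ι R →ₙ* Matrix ι ι S) A B (w k)
  simpa using congrFun (congrArg vec this) x

theorem continuous_wordDet [TopologicalSpace R] [IsTopologicalRing R]
    (w : ι × ι → FreeSemigroup Bool) :
    Continuous fun p : Matrix ι ι R × Matrix ι ι R => wordDet w p.1 p.2 := by
  refine Continuous.matrix_det (continuous_matrix fun k x => ?_)
  exact (continuous_wordEval (w k)).matrix_elem x.2 x.1

end wordDet

/-- A pair of matrices over a field generates the matrix algebra if and only if some family of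
words in the pair has linearly independent values. -/
theorem generates_iff_exists_wordDet_ne_zero {F : Type*} [Field F] {n : ℕ}
    (A B : Matrix (Fin n) (Fin n) F) :
    Generates F A B ↔ ∃ w, wordDet w A B ≠ 0 := by
  have hspan : Generates F A B ↔ Submodule.span F (Set.range (wordEval A B)) = ⊤ := by
    rw [Generates, ← coe_closure_pair_eq_range_wordEval, ← NonUnitalAlgebra.adjoin_eq_span,
      ← NonUnitalAlgebra.toSubmodule_eq_top]
  have hdet (w : Fin n × Fin n → FreeSemigroup Bool) :
      wordDet w A B ≠ 0 ↔ LinearIndependent F (wordEval A B ∘ w) := by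
    rw [wordDet, ← isUnit_iff_ne_zero, ← Matrix.isUnit_iff_isUnit_det,
      ← Matrix.linearIndependent_rows_iff_isUnit]
    let e : Matrix (Fin n) (Fin n) F →ₗ[F] (Fin n × Fin n → F) :=
      { toFun := vec, map_add' := fun _ _ => rfl, map_smul' := fun _ _ => rfl }
    exact e.linearIndependent_iff (v := wordEval A B ∘ w)
      (LinearMap.ker_eq_bot.2 fun _ _ h => vec_inj.1 h)
  have hcard : Fintype.card (Fin n × Fin n) = Module.finrank F (Matrix (Fin n) (Fin n) F) := by
    simp [Module.finrank_matrix]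
  simp only [hspan, hdet]
  constructor
  · intro h
    obtain ⟨κ, a, -, hsp, hli⟩ := exists_linearIndependent' F (wordEval A B)
    let b := Module.Basis.mk hli (by rw [hsp, h])
    let e := b.indexEquiv (Matrix.stdBasis F (Fin n) (Fin n))
    exact ⟨a ∘ e.symm, hli.comp _ e.symm.injective⟩
  · rintro ⟨w, hw⟩
    rw [eq_top_iff, ← hw.span_eq_top_of_card_eq_finrank' hcard]
    exact Submodule.span_mono (Set.range_comp_subset_range _ _)

theorem exists_generates (R : Type*) [CommRing R] (n : ℕ) :
    ∃ A B : Matrix (Fin n) (Fin n) R, Generates R A B := by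
  obtain _ | n := n
  · exact ⟨0, 0, Subsingleton.elim _ _⟩
  let N : Matrix (Fin (n + 1)) (Fin (n + 1)) R :=
    ∑ k : Fin n, Matrix.single k.castSucc k.succ 1
  let E : Matrix (Fin (n + 1)) (Fin (n + 1)) R := Matrix.single (Fin.last n) 0 1
  have left_mul (i : Fin n) (j : Fin (n + 1)) :
      N * Matrix.single i.succ j 1 = Matrix.single i.castSucc j 1 := by
    rw [Finset.sum_mul, Finset.sum_eq_single i]
    · simp
    · intro k _ hk
      exact Matrix.single_mul_single_of_ne _ _ _ _ (by simpa using hk) _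
    · simp
  have mul_right (i : Fin (n + 1)) (j : Fin n) :
      Matrix.single i j.castSucc 1 * N = Matrix.single i j.succ 1 := by
    rw [Finset.mul_sum, Finset.sum_eq_single j]
    · simp
    · intro k _ hk
      exact Matrix.single_mul_single_of_ne _ _ _ _ (by simpa using hk.symm) _
    · simp
  refine ⟨N, E, ?_⟩
  set S := NonUnitalAlgebra.adjoin R ({N, E} : Set (Matrix (Fin (n + 1)) (Fin (n + 1)) R)) with hS
  have hN : N ∈ S := NonUnitalAlgebra.subset_adjoin R (by simp)
  have hE : E ∈ S := NonUnitalAlgebra.subset_adjoin R (by simp)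
  have hcol (i : Fin (n + 1)) : Matrix.single i 0 1 ∈ S := by
    induction i using Fin.reverseInduction with
    | last => exact hE
    | cast i ih => rw [← left_mul]; exact mul_mem hN ih
  have hsingle (i j : Fin (n + 1)) : Matrix.single i j 1 ∈ S := by
    induction j using Fin.induction with
    | zero => exact hcol i
    | succ j ih => rw [← mul_right]; exact mul_mem ih hN
  rw [Generates, ← hS, eq_top_iff]
  intro X _
  rw [Matrix.matrix_eq_sum_single X]
  refine sum_mem fun i _ => sum_mem fun j _ => ?_
  rw [← mul_one (X i j), ← smul_eq_mul, ← Matrix.smul_single]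
  exact S.smul_mem (X i j) (hsingle i j)

theorem isOpen_setOf_generates (F : Type*) [Field F] [TopologicalSpace F] [IsTopologicalRing F]
    [T1Space F] (n : ℕ) :
    IsOpen { p : Matrix (Fin n) (Fin n) F × Matrix (Fin n) (Fin n) F | Generates F p.1 p.2 } := by
  simp only [generates_iff_exists_wordDet_ne_zero, Set.ofPred_exists]
  exact isOpen_iUnion fun w => isOpen_ne.preimage (continuous_wordDet w)

open Polynomial in
/-- Generating pairs are dense: on the line joining any pair to a generating pair, all but finitely
many points are generating pairs. -/
theorem dense_setOf_generates (F : Type*) [Field F] [TopologicalSpace F] [IsTopologicalRing F]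
    [T1Space F] [∀ x : F, (𝓝[≠] x).NeBot] (n : ℕ) :
    Dense { p : Matrix (Fin n) (Fin n) F × Matrix (Fin n) (Fin n) F | Generates F p.1 p.2 } := by
  rintro ⟨A, B⟩
  obtain ⟨A', B', h⟩ := exists_generates F n
  obtain ⟨w, hw⟩ := (generates_iff_exists_wordDet_ne_zero A' B').1 h
  let line (X Y : Matrix (Fin n) (Fin n) F) (t : F) := X + t • (Y - X)
  let polyLine (X Y : Matrix (Fin n) (Fin n) F) : Matrix (Fin n) (Fin n) F[X] :=
    Matrix.of fun i j => C (X i j) + Polynomial.X * C (Y i j - X i j)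
  let P : F[X] := wordDet w (polyLine A A') (polyLine B B')
  have map_polyLine (X Y : Matrix (Fin n) (Fin n) F) (t : F) :
      (polyLine X Y).map (evalRingHom t) = line X Y t := by
    ext i j
    simp [polyLine, line]
  have hP (t : F) : P.eval t = wordDet w (line A A' t) (line B B' t) := by
    rw [← coe_evalRingHom, map_wordDet, map_polyLine, map_polyLine]
  have hP0 : P ≠ 0 := by
    rintro h0
    apply hw
    simpa [h0, line] using (hP 1).symm
  have hdense : Dense (Set.univ \ {t | P.IsRoot t}) :=
    dense_univ.sdiff_finite (finite_setOfPred_isRoot hP0)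
  have hcont : Continuous fun t : F => (line A A' t, line B B' t) := by
    fun_prop
  have hmem := map_mem_closure hcont (hdense 0) (t := {p | Generates F p.1 p.2}) fun t ht =>
    (generates_iff_exists_wordDet_ne_zero _ _).2 ⟨w, by rw [← hP]; exact ht.2⟩
  simpa [line] using hmem

theorem stmt_8 (F : Type*) [NormedField F]
    (hF : ∀ ε : ℝ, 0 < ε → ∃ a : F, a ≠ 0 ∧ ‖a‖ < ε)
    (n : ℕ) (hn : 2 ≤ n) :
    IsOpen { p : Matrix (Fin n) (Fin n) F × Matrix (Fin n) (Fin n) F |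
        Generates F p.1 p.2 } ∧
      Dense { p : Matrix (Fin n) (Fin n) F × Matrix (Fin n) (Fin n) F |
        Generates F p.1 p.2 } := by
  obtain ⟨a, ha, ha1⟩ := hF 1 one_pos
  let : NontriviallyNormedField F := NontriviallyNormedField.ofNormNeOne ⟨a, ha, ha1.ne⟩
  exact ⟨isOpen_setOf_generates F n, dense_setOf_generates F n⟩
end

section
/- Let F be a finite field with q elements and let f be a nonzero polynomial in two variables over F. Then the number of points (a,b) ∈ F² with f(a,b) = 0 is at most 2·q·deg(f), where deg(f) is the total degree of f. -/
theorem stmt_9 (F : Type*) [Field F] [Fintype F]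
    (f : MvPolynomial (Fin 2) F) (hf : f ≠ 0) :
    { x : Fin 2 → F | MvPolynomial.eval x f = 0 }.ncard ≤
      2 * Fintype.card F * f.totalDegree := by
  classical
  have hq : (0 : ℚ≥0) < Fintype.card F := by exact_mod_cast Fintype.card_pos
  have h := MvPolynomial.schwartz_zippel_totalDegree hf Finset.univ
  rw [Fintype.piFinset_univ, Finset.card_univ, div_le_div_iff₀ (by positivity) hq, pow_two,
    ← mul_assoc] at h
  have hcard : (Finset.univ.filter fun x ↦ MvPolynomial.eval x f = 0).card ≤
      f.totalDegree * Fintype.card F := by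
    exact_mod_cast le_of_mul_le_mul_right h hq
  rw [Set.ncard_eq_toFinset_card', Set.toFinset_ofPred]
  calc
    _ ≤ f.totalDegree * Fintype.card F := hcard
    _ ≤ 2 * Fintype.card F * f.totalDegree := by
      rw [mul_comm, mul_assoc]
      exact Nat.le_mul_of_pos_left _ two_pos
end

section
/- Let n ≥ 2. The ring homomorphism φ_n : ℤ⟨x,y⟩ → M_n(ℤ) determined by φ_n(x) = X and φ_n(y) = Y is surjective, and its kernel equals the two-sided ideal of ℤ⟨x,y⟩ generated by the n+1 elements r_{1,n} = xⁿ − 1, r_{2,n} = (Σ_{i=0}^{n−1} x^{n−i} y x^i) − 1, and s_j = y x^j y for 1 ≤ j ≤ n−1. In particular M_n(ℤ) ≅ ℤ⟨x,y⟩ / (r_{1,n}, r_{2,n}, s_1, …, s_{n−1}). -/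
/-- The `n × n` cyclic permutation matrix `X = E₂₁ + E₃₂ + ⋯ + E_{n,n-1} + E_{1n}`,
with `X i j = 1` iff `i ≡ j + 1 (mod n)`. -/
def Xmat (n : ℕ) : Matrix (Fin n) (Fin n) ℤ :=
  Matrix.of fun i j => if (i : ℕ) = ((j : ℕ) + 1) % n then 1 else 0

/-- The matrix unit `Y = E₁₁`. -/
def Ymat (n : ℕ) : Matrix (Fin n) (Fin n) ℤ :=
  Matrix.of fun i j => if (i : ℕ) = 0 ∧ (j : ℕ) = 0 then 1 else 0

/-- The generator `x` of the free ring `ℤ⟨x,y⟩ = FreeAlgebra ℤ (Fin 2)`. -/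
noncomputable def fx : FreeAlgebra ℤ (Fin 2) := FreeAlgebra.ι ℤ 0

/-- The generator `y` of the free ring `ℤ⟨x,y⟩ = FreeAlgebra ℤ (Fin 2)`. -/
noncomputable def fy : FreeAlgebra ℤ (Fin 2) := FreeAlgebra.ι ℤ 1

/-- The ring homomorphism `φₙ : ℤ⟨x,y⟩ → Mₙ(ℤ)` sending `x ↦ X`, `y ↦ Y`. -/
noncomputable def phi (n : ℕ) : FreeAlgebra ℤ (Fin 2) →ₐ[ℤ] Matrix (Fin n) (Fin n) ℤ :=
  FreeAlgebra.lift ℤ ![Xmat n, Ymat n]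

/-- `r_{1,n} = xⁿ - 1`. -/
noncomputable def r1 (n : ℕ) : FreeAlgebra ℤ (Fin 2) := fx ^ n - 1

/-- `r_{2,n} = (Σ_{i=0}^{n-1} x^{n-i} y x^i) - 1`. -/
noncomputable def r2 (n : ℕ) : FreeAlgebra ℤ (Fin 2) :=
  (∑ i ∈ Finset.range n, fx ^ (n - i) * fy * fx ^ i) - 1

/-- `s₀ = y² - y`. -/
noncomputable def s0 : FreeAlgebra ℤ (Fin 2) := fy ^ 2 - fy

/-- `s_j = y x^j y`. -/
noncomputable def s (j : ℕ) : FreeAlgebra ℤ (Fin 2) := fy * fx ^ j * fy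

/-- Entries of the powers of the cyclic permutation matrix. -/
theorem Xmat_pow_apply (n k : ℕ) (i j : Fin n) :
    (Xmat n ^ k) i j = if (i : ℕ) = ((j : ℕ) + k) % n then 1 else 0 := by
  have hn : 0 < n := i.pos
  induction k generalizing i with
  | zero =>
    simp [Matrix.one_apply, Fin.ext_iff, Nat.mod_eq_of_lt j.isLt]
  | succ k ih =>
    rw [pow_succ', Matrix.mul_apply,
      Finset.sum_eq_single ⟨((j : ℕ) + k) % n, Nat.mod_lt _ hn⟩]
    · rw [ih]
      simp [Xmat, add_assoc]
    · intro b _ hb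
      rw [ih, if_neg (fun h => hb (Fin.ext h)), mul_zero]
    · simp

/-- Entries of `X ^ k * Y * X ^ l`. -/
theorem Xmat_pow_mul_Ymat_mul_apply (n k l : ℕ) (i j : Fin n) :
    (Xmat n ^ k * Ymat n * Xmat n ^ l) i j =
      if (i : ℕ) = k % n ∧ ((j : ℕ) + l) % n = 0 then 1 else 0 := by
  have hn : 0 < n := i.pos
  rw [Matrix.mul_apply, Finset.sum_eq_single ⟨0, hn⟩]
  · rw [Matrix.mul_apply, Finset.sum_eq_single ⟨0, hn⟩]
    · simp only [Xmat_pow_apply, Ymat, Matrix.of_apply, zero_add, and_self, if_true, mul_one]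
      by_cases h₁ : (i : ℕ) = k % n <;> by_cases h₂ : ((j : ℕ) + l) % n = 0 <;>
        simp [h₁, h₂, eq_comm]
    · intro b _ hb
      have : (b : ℕ) ≠ 0 := fun h => hb (Fin.ext h)
      simp [Ymat, this]
    · simp
  · intro b _ hb
    have hb' : (b : ℕ) ≠ 0 := fun h => hb (Fin.ext h)
    rw [Matrix.mul_apply, Finset.sum_eq_zero, zero_mul]
    intro c _
    simp [Ymat, hb']
  · simp

theorem Xmat_pow_self (n : ℕ) : Xmat n ^ n = 1 := by
  ext i j
  simp [Xmat_pow_apply, Matrix.one_apply, Fin.ext_iff, Nat.mod_eq_of_lt j.isLt]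

theorem sum_Xmat_pow_mul_Ymat_mul (n : ℕ) :
    ∑ i ∈ Finset.range n, Xmat n ^ (n - i) * Ymat n * Xmat n ^ i = 1 := by
  ext a b
  have hn : 0 < n := a.pos
  have ha := a.isLt
  have hb := b.isLt
  rw [Matrix.sum_apply, Finset.sum_eq_single ((n - (a : ℕ)) % n)]
  · rw [Xmat_pow_mul_Ymat_mul_apply, Matrix.one_apply]
    refine if_congr ?_ rfl rfl
    rw [Fin.ext_iff]
    rcases Nat.eq_zero_or_pos (a : ℕ) with h | h
    · simp [h, Nat.mod_eq_of_lt hb, eq_comm]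
    · rw [Nat.mod_eq_of_lt (show n - (a : ℕ) < n by omega),
        show n - (n - (a : ℕ)) = a by omega, Nat.mod_eq_of_lt ha]
      constructor
      · rintro ⟨-, h'⟩
        obtain ⟨c, hc⟩ := Nat.dvd_of_mod_eq_zero h'
        have h1 : 0 < c := by
          rcases Nat.eq_zero_or_pos c with rfl | h
          · omega
          · exact h
        have h2 : c < 2 := by
          by_contra! h2
          have := Nat.mul_le_mul_left n h2
          omega
        obtain rfl : c = 1 := by omega
        omega
      · intro h'
        rw [← h', show (a : ℕ) + (n - a) = n by omega, Nat.mod_self]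
        exact ⟨rfl, rfl⟩
  · intro i hi hne
    rw [Finset.mem_range] at hi
    rw [Xmat_pow_mul_Ymat_mul_apply, if_neg]
    rintro ⟨h, -⟩
    apply hne
    rcases Nat.eq_zero_or_pos i with rfl | h0
    · simp at h
      simp [h]
    · rw [Nat.mod_eq_of_lt (by omega)] at h
      rw [h, show n - (n - i) = i by omega, Nat.mod_eq_of_lt hi]
  · intro h
    exact absurd (Finset.mem_range.2 (Nat.mod_lt _ hn)) h

theorem Ymat_mul_Xmat_pow_mul_Ymat (n j : ℕ) (h₁ : 1 ≤ j) (h₂ : j ≤ n - 1) :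
    Ymat n * Xmat n ^ j * Ymat n = 0 := by
  ext a b
  have hn : 0 < n := a.pos
  rw [Matrix.mul_apply, Finset.sum_eq_zero, Matrix.zero_apply]
  intro c _
  have := Xmat_pow_mul_Ymat_mul_apply n 0 j a c
  rw [pow_zero, one_mul] at this
  rw [this]
  by_cases hc : (c : ℕ) = 0
  · rw [if_neg, zero_mul]
    rw [hc, zero_add, Nat.mod_eq_of_lt (show j < n by omega)]
    omega
  · simp [Ymat, hc]

@[simp]
theorem phi_fx (n : ℕ) : phi n fx = Xmat n := by
  simp [phi, fx]

@[simp]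
theorem phi_fy (n : ℕ) : phi n fy = Ymat n := by
  simp [phi, fy]

theorem phi_surjective (n : ℕ) : Function.Surjective (phi n) := by
  have hsingle (a b : Fin n) :
      phi n (fx ^ (a : ℕ) * fy * fx ^ (n - (b : ℕ))) = Matrix.single a b 1 := by
    ext i j
    have ha := a.isLt
    have hb := b.isLt
    have hj := j.isLt
    rw [map_mul, map_mul, map_pow, map_pow, phi_fx, phi_fy, Xmat_pow_mul_Ymat_mul_apply,
      Matrix.single_apply]
    refine if_congr ?_ rfl rfl
    rw [Nat.mod_eq_of_lt ha, Fin.ext_iff, Fin.ext_iff, eq_comm (a := (i : ℕ))]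
    refine and_congr_right fun _ => ⟨fun h => ?_, fun h => ?_⟩
    · rcases lt_trichotomy (b : ℕ) j with h' | h' | h'
      · rw [show (j : ℕ) + (n - b) = (j - b) + n by omega, Nat.add_mod_right,
          Nat.mod_eq_of_lt (by omega)] at h
        omega
      · exact h'
      · rw [Nat.mod_eq_of_lt (by omega)] at h
        omega
    · rw [h, show (j : ℕ) + (n - j) = n by omega, Nat.mod_self]
  intro M
  refine ⟨∑ a, ∑ b, M a b • (fx ^ (a : ℕ) * fy * fx ^ (n - (b : ℕ))), ?_⟩
  conv_rhs => rw [Matrix.matrix_eq_sum_single M]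
  simp only [map_sum, map_zsmul, hsingle, Matrix.smul_single, smul_eq_mul, mul_one]

section MatrixUnits

variable {R : Type*} [Ring R] {n : ℕ} {x y : R}

theorem mul_self_of_sum_eq_one (hx : x ^ n = 1) (hn : 0 < n)
    (hsum : ∑ i ∈ Finset.range n, x ^ (n - i) * y * x ^ i = 1)
    (hs : ∀ j, 1 ≤ j → j ≤ n - 1 → y * x ^ j * y = 0) : y * y = y := by
  have h := congrArg (y * ·) hsum
  simp only [Finset.mul_sum, mul_one] at h
  rw [Finset.sum_eq_single 0] at h
  · simpa [hx] using h
  · intro i hi hi0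
    rw [Finset.mem_range] at hi
    rw [← mul_assoc, ← mul_assoc, hs (n - i) (by omega) (by omega), zero_mul]
  · intro h0
    exact absurd (Finset.mem_range.2 hn) h0

/-- The additive map sending the matrix unit `E i j` to `x ^ i * y * x ^ (n - j)`. -/
def matrixUnitMap (x y : R) : Matrix (Fin n) (Fin n) ℤ →+ R where
  toFun A := ∑ i, ∑ j, A i j • (x ^ (i : ℕ) * y * x ^ (n - (j : ℕ)))
  map_zero' := by simp
  map_add' A B := by simp [add_smul, Finset.sum_add_distrib]

theorem matrixUnitMap_apply (x y : R) (A : Matrix (Fin n) (Fin n) ℤ) :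
    matrixUnitMap x y A = ∑ i, ∑ j, A i j • (x ^ (i : ℕ) * y * x ^ (n - (j : ℕ))) :=
  rfl

theorem pow_mod_of_pow_eq_one (hx : x ^ n = 1) (k : ℕ) : x ^ (k % n) = x ^ k := by
  conv_rhs => rw [← Nat.mod_add_div k n, pow_add, pow_mul, hx, one_pow, mul_one]

theorem matrixUnitMap_one (hx : x ^ n = 1)
    (hsum : ∑ i ∈ Finset.range n, x ^ (n - i) * y * x ^ i = 1) :
    matrixUnitMap x y (1 : Matrix (Fin n) (Fin n) ℤ) = 1 := by
  have h : matrixUnitMap x y (1 : Matrix (Fin n) (Fin n) ℤ) =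
      ∑ i ∈ Finset.range n, x ^ i * y * x ^ (n - i) := by
    rw [matrixUnitMap_apply, ← Fin.sum_univ_eq_sum_range (fun i => x ^ i * y * x ^ (n - i))]
    simp [Matrix.one_apply, ite_smul]
  rw [h, ← hsum]
  cases n with
  | zero => simp
  | succ m =>
    rw [Finset.sum_range_succ', Finset.sum_range_succ', ← Finset.sum_range_reflect]
    congr 1
    · refine Finset.sum_congr rfl fun i hi => ?_
      rw [Finset.mem_range] at hi
      rw [show m - 1 - i + 1 = m + 1 - (i + 1) by omega,
        show m + 1 - (m + 1 - (i + 1)) = i + 1 by omega]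
    · simp [hx]

theorem matrixUnitMap_Xmat_mul (hx : x ^ n = 1) (A : Matrix (Fin n) (Fin n) ℤ) :
    matrixUnitMap x y (Xmat n * A) = x * matrixUnitMap x y A := by
  simp only [matrixUnitMap_apply, Matrix.mul_apply, Finset.sum_smul, Finset.mul_sum]
  have hcomm (i : Fin n) :
      ∑ j, ∑ k, (Xmat n i k * A k j) • (x ^ (i : ℕ) * y * x ^ (n - (j : ℕ))) =
        ∑ k, ∑ j, (Xmat n i k * A k j) • (x ^ (i : ℕ) * y * x ^ (n - (j : ℕ))) :=
    Finset.sum_comm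
  rw [Finset.sum_congr rfl fun i _ => hcomm i, Finset.sum_comm]
  refine Finset.sum_congr rfl fun k _ => ?_
  rw [Finset.sum_comm]
  refine Finset.sum_congr rfl fun j _ => ?_
  rw [Finset.sum_eq_single ⟨((k : ℕ) + 1) % n, Nat.mod_lt _ k.pos⟩]
  · rw [mul_smul_comm]
    simp [Xmat, pow_mod_of_pow_eq_one hx, pow_succ', mul_assoc]
  · intro b _ hb
    have : ¬ (b : ℕ) = ((k : ℕ) + 1) % n := fun h => hb (Fin.ext h)
    simp [Xmat, this]
  · simp

theorem matrixUnitMap_Ymat_mul (hy : y * y = y)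
    (hs : ∀ j, 1 ≤ j → j ≤ n - 1 → y * x ^ j * y = 0) (A : Matrix (Fin n) (Fin n) ℤ) :
    matrixUnitMap x y (Ymat n * A) = y * matrixUnitMap x y A := by
  simp only [matrixUnitMap_apply, Finset.mul_sum]
  refine Finset.sum_congr rfl fun i _ => Finset.sum_congr rfl fun j _ => ?_
  rw [mul_smul_comm, ← mul_assoc, ← mul_assoc, Matrix.mul_apply]
  by_cases hi : (i : ℕ) = 0
  · rw [Finset.sum_eq_single i]
    · simp [Ymat, hi, hy]
    · intro b _ hb
      have : (b : ℕ) ≠ 0 := fun h => hb (Fin.ext (h.trans hi.symm))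
      simp [Ymat, this]
    · simp
  · rw [hs i (by omega) (by omega)]
    simp [Ymat, hi]

end MatrixUnits

/-- A ring homomorphism out of the free ring that respects the relations factors additively
through `phi n`. -/
theorem matrixUnitMap_phi {R : Type*} [Ring R] {n : ℕ} (hn : 0 < n)
    (f : FreeAlgebra ℤ (Fin 2) →+* R) (hr₁ : f (r1 n) = 0) (hr₂ : f (r2 n) = 0)
    (hs : ∀ j, 1 ≤ j → j ≤ n - 1 → f (s j) = 0) (a : FreeAlgebra ℤ (Fin 2)) :
    matrixUnitMap (f fx) (f fy) (phi n a) = f a := by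
  have hx : f fx ^ n = 1 := by simpa [r1, sub_eq_zero] using hr₁
  have hsum : ∑ i ∈ Finset.range n, f fx ^ (n - i) * f fy * f fx ^ i = 1 := by
    simpa [r2, sub_eq_zero] using hr₂
  have hs' : ∀ j, 1 ≤ j → j ≤ n - 1 → f fy * f fx ^ j * f fy = 0 := fun j h₁ h₂ => by
    simpa [s] using hs j h₁ h₂
  have hy := mul_self_of_sum_eq_one hx hn hsum hs'
  have key : ∀ A, matrixUnitMap (f fx) (f fy) (phi n a * A) =
      f a * matrixUnitMap (f fx) (f fy) A := by
    induction a using FreeAlgebra.induction with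
    | grade0 r =>
      intro A
      rw [AlgHom.commutes]
      simp [← zsmul_eq_mul]
    | grade1 i =>
      intro A
      fin_cases i
      · exact (congrArg (fun M => matrixUnitMap (f fx) (f fy) (M * A)) (phi_fx n)).trans
          (matrixUnitMap_Xmat_mul hx A)
      · exact (congrArg (fun M => matrixUnitMap (f fx) (f fy) (M * A)) (phi_fy n)).trans
          (matrixUnitMap_Ymat_mul hy hs' A)
    | mul a b ha hb =>
      intro A
      rw [map_mul (phi n), map_mul f, mul_assoc, ha, hb, mul_assoc]
    | add a b ha hb =>
      intro A
      rw [map_add, map_add, add_mul, add_mul, map_add, ha, hb]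
  simpa [matrixUnitMap_one hx hsum] using key 1


theorem stmt_11 (n : ℕ) (hn : 2 ≤ n) :
    Function.Surjective (phi n) ∧
      TwoSidedIdeal.ker (phi n) =
        TwoSidedIdeal.span
          ({r1 n, r2 n} ∪ { a | ∃ j, 1 ≤ j ∧ j ≤ n - 1 ∧ a = s j }) := by
  refine ⟨phi_surjective n, le_antisymm ?_ ?_⟩
  · intro a ha
    rw [TwoSidedIdeal.mem_ker] at ha
    set I := TwoSidedIdeal.span
      ({r1 n, r2 n} ∪ { a | ∃ j, 1 ≤ j ∧ j ≤ n - 1 ∧ a = s j }) with hI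
    have hmem (b : FreeAlgebra ℤ (Fin 2)) : I.ringCon.mk' b = 0 ↔ b ∈ I := by
      rw [← TwoSidedIdeal.mem_ker, TwoSidedIdeal.ker_ringCon_mk']
    have h := matrixUnitMap_phi (by omega) I.ringCon.mk'
      ((hmem _).2 (TwoSidedIdeal.subset_span (by simp)))
      ((hmem _).2 (TwoSidedIdeal.subset_span (by simp)))
      (fun j h₁ h₂ => (hmem _).2 (TwoSidedIdeal.subset_span (Or.inr ⟨j, h₁, h₂, rfl⟩))) a
    rw [ha, map_zero] at h
    exact (hmem a).1 h.symm
  · rw [TwoSidedIdeal.span_le]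
    rintro a ((rfl | rfl) | ⟨j, h₁, h₂, rfl⟩) <;>
      rw [SetLike.mem_coe, TwoSidedIdeal.mem_ker]
    · simp [r1, Xmat_pow_self]
    · simp [r2, sum_Xmat_pow_mul_Ymat_mul]
    · simp [s, Ymat_mul_Xmat_pow_mul_Ymat n j h₁ h₂]
end

section
/- Let n ≥ 2 and let k be an integer with 1 ≤ k ≤ n−1 and 2k ≠ n. Then the element s_k = y x^k y of ℤ⟨x,y⟩ belongs to the two-sided ideal generated by r_{1,n} = xⁿ − 1, r_{2,n} = (Σ_{i=0}^{n−1} x^{n−i} y x^i) − 1, and the elements s_j = y x^j y for 1 ≤ j ≤ n−1 with j ≠ k. (That is, the relation s_k = 0 follows from the remaining relations of the presentation of M_n(ℤ) by r_{1,n}, r_{2,n}, s_1, …, s_{n−1}.) -/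
/-- In any ring, the relations `xⁿ = 1`, `Σ x^{n-i} y x^i = 1` and `y x^j y = 0` for `0 < j < n`,
`j ≠ k`, force `y x^k y = 0` as soon as `2k ≠ n`. -/
theorem mul_pow_mul_eq_zero_of_relations {A : Type*} [Ring A] {x y : A} {n k : ℕ}
    (hk : 0 < k) (hkn : k < n) (hk2 : 2 * k ≠ n) (hx : x ^ n = 1)
    (hsum : ∑ i ∈ Finset.range n, x ^ (n - i) * y * x ^ i = 1)
    (hs : ∀ j, 0 < j → j < n → j ≠ k → y * x ^ j * y = 0) :
    y * x ^ k * y = 0 := by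
  have huv : x ^ k * x ^ (n - k) = 1 := by rw [← pow_add, Nat.add_sub_cancel' hkn.le, hx]
  have hvu : x ^ (n - k) * x ^ k = 1 := by rw [← pow_add, Nat.sub_add_cancel hkn.le, hx]
  have hl : y = y * y + y * x ^ k * y * x ^ (n - k) := by
    have h := congrArg (y * ·) hsum
    simp only [Finset.mul_sum, mul_one] at h
    rw [Finset.sum_eq_add_of_mem 0 (n - k) (by simp; omega) (by simp; omega) (by omega)] at h
    · simpa [hx, Nat.sub_sub_self hkn.le, mul_assoc] using h.symm
    · intro i hi hne
      rw [Finset.mem_range] at hi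
      rw [← mul_assoc, ← mul_assoc, hs (n - i) (by omega) (by omega) (by omega), zero_mul]
  have hr : y = y * y + x ^ (n - k) * (y * x ^ k * y) := by
    have h := congrArg (· * y) hsum
    simp only [Finset.sum_mul, one_mul] at h
    rw [Finset.sum_eq_add_of_mem 0 k (by simp; omega) (by simp; omega) (by omega)] at h
    · simpa [hx, mul_assoc] using h.symm
    · intro i hi hne
      rw [Finset.mem_range] at hi
      rw [mul_assoc, mul_assoc, ← mul_assoc y, hs i (by omega) hi (by omega), mul_zero]
  have hv : y * x ^ (n - k) * y = 0 := hs _ (by omega) (by omega) (by omega)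
  generalize x ^ k = u at *
  generalize x ^ (n - k) = v at *
  have hl' : y * u * y * v = y - y * y := eq_sub_of_add_eq' hl.symm
  have hr' : v * (y * u * y) = y - y * y := eq_sub_of_add_eq' hr.symm
  have hsl : y * u * y = (y - y * y) * u := by rw [← hl', mul_assoc _ v, hvu, mul_one]
  have hsr : y * u * y = u * (y - y * y) := by rw [← hr', ← mul_assoc u, huv, one_mul]
  have hyy : y * (y - y * y) = 0 := by
    rw [← hr', show y * (v * (y * u * y)) = y * v * y * (u * y) by noncomm_ring, hv, zero_mul]
  have hys : y * (y * u * y) = 0 := by rw [hsl, ← mul_assoc, hyy, zero_mul]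
  have hsy : y * u * y * y = 0 := by
    rw [hsr, mul_assoc, show (y - y * y) * y = y * (y - y * y) by noncomm_ring, hyy, mul_zero]
  calc y * u * y = y * (u * (y - y * y)) + y * u * y * y := by noncomm_ring
    _ = 0 := by rw [← hsr, hys, hsy, add_zero]

theorem stmt_15 (n k : ℕ) (hn : 2 ≤ n) (hk1 : 1 ≤ k) (hk2 : k ≤ n - 1)
    (hk3 : 2 * k ≠ n) :
    s k ∈ TwoSidedIdeal.span
      ({r1 n, r2 n} ∪ { a | ∃ j, 1 ≤ j ∧ j ≤ n - 1 ∧ j ≠ k ∧ a = s j }) := by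
  set I := TwoSidedIdeal.span
    ({r1 n, r2 n} ∪ { a | ∃ j, 1 ≤ j ∧ j ≤ n - 1 ∧ j ≠ k ∧ a = s j })
  let q : FreeAlgebra ℤ (Fin 2) →+* I.ringCon.Quotient := I.ringCon.mk'
  have hq : ∀ a, a ∈ I ↔ q a = 0 := fun a => by
    rw [TwoSidedIdeal.mem_iff]
    exact (RingCon.eq I.ringCon).symm
  have hr1 : q (r1 n) = 0 := (hq _).1 (TwoSidedIdeal.subset_span (by simp))
  have hr2 : q (r2 n) = 0 := (hq _).1 (TwoSidedIdeal.subset_span (by simp))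
  have hs : ∀ j, 0 < j → j < n → j ≠ k → q (s j) = 0 := fun j h0 hn' hjk =>
    (hq _).1 (TwoSidedIdeal.subset_span (Or.inr ⟨j, h0, by omega, hjk, rfl⟩))
  simp only [r1, r2, s, map_sub, map_sum, map_mul, map_pow, map_one, sub_eq_zero] at hr1 hr2 hs
  rw [hq]
  simp only [s, map_mul, map_pow]
  exact mul_pow_mul_eq_zero_of_relations hk1 (by omega) hk3 hr1 hr2 hs
end
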